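/- Let O be a convex subring of ℝ* closed under *exp, with maximal ideal o := {x ∈ ℝ* : x = 0 ∨ x⁻¹ ∉ O}, residue field O/o (a linearly ordered field via π(x) ≤ π(y) iff x ≤ y or x − y ∈ o, where π : O → O/o is the quotient map). Then there exist mutually inverse functions E : O/o → {u ∈ O/o : u > 0} and L : {u ∈ O/o : u > 0} → O/o such that: E(π(f)) = π(*exp(f)) for all f ∈ O; L(π(g)) = π(*log(g)) for all g ∈ O with π(g) > 0; E(a + b) = E(a)·E(b) for all a, b ∈ O/o; and E is strictly increasing. In particular E is an isomorphism from the ordered additive group of O/o onto the ordered multiplicative group of positive elements of O/o, making O/o an exponential field. -/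

import Mathlib

/-- The nonstandard extension of the real exponential function. -/
noncomputable def starExp : Hyperreal → Hyperreal :=
  Filter.Germ.map Real.exp

/-- The nonstandard extension of the real logarithm function. -/
noncomputable def starLog : Hyperreal → Hyperreal :=
  Filter.Germ.map Real.log

lemma starExp_add (x y : Hyperreal) : starExp (x + y) = starExp x * starExp y := by
  induction x using Filter.Germ.inductionOn with | _ x
  induction y using Filter.Germ.inductionOn with | _ y
  exact congrArg (fun f : ℕ → ℝ => Hyperreal.ofSeq f) (funext fun n => Real.exp_add (x n) (y n))

lemma starExp_zero : starExp 0 = 1 :=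
  congrArg (fun f : ℕ → ℝ => Hyperreal.ofSeq f) (funext fun _ => Real.exp_zero)

lemma starExp_lower (x : Hyperreal) : x + 1 ≤ starExp x := by
  induction x using Filter.Germ.inductionOn with | _ x
  exact Filter.Germ.coe_le.2 (Filter.Eventually.of_forall fun n => Real.add_one_le_exp (x n))

lemma starExp_nonneg (x : Hyperreal) : 0 ≤ starExp x := by
  induction x using Filter.Germ.inductionOn with | _ x
  exact Filter.Germ.coe_le.2 (Filter.Eventually.of_forall fun n => Real.exp_nonneg (x n))

lemma starExp_mul_neg (x : Hyperreal) : starExp x * starExp (-x) = 1 := by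
  rw [← starExp_add, add_neg_cancel, starExp_zero]

lemma starExp_pos (x : Hyperreal) : 0 < starExp x := by
  refine lt_of_le_of_ne (starExp_nonneg x) fun h => ?_
  have := starExp_mul_neg x
  rw [← h, zero_mul] at this
  exact zero_ne_one this

lemma starExp_mono {x y : Hyperreal} (h : x ≤ y) : starExp x ≤ starExp y := by
  have h1 := starExp_lower (y - x)
  have h2 : starExp y = starExp x * starExp (y - x) := by
    rw [← starExp_add]; congr 1; ring
  rw [h2]
  have := starExp_pos x
  nlinarith

lemma starExp_starLog {x : Hyperreal} (h : 0 < x) : starExp (starLog x) = x := by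
  induction x using Filter.Germ.inductionOn with | _ x
  have h' := Filter.Germ.coe_lt.1 (show Hyperreal.ofSeq (fun _ => 0) < Hyperreal.ofSeq x from h)
  exact Filter.Germ.coe_eq.2 (h'.mono fun n hn => Real.exp_log hn)

lemma abs_starExp_sub_one (d : Hyperreal) :
    |starExp d - 1| ≤ |d * (1 + starExp d)| := by
  have h1 := starExp_lower d
  have h2 := starExp_lower (-d)
  have h3 := starExp_pos d
  have h4 := starExp_mul_neg d
  have h5 : starExp d - 1 ≤ d * starExp d := by nlinarith
  rw [abs_mul, abs_of_pos (by linarith : 0 < 1 + starExp d), abs_le]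
  have := neg_abs_le d
  have := le_abs_self d
  constructor <;> nlinarith [abs_nonneg d]

lemma abs_le_starExp_sub_one (d : Hyperreal) :
    |d| ≤ |(starExp d - 1) * (1 + starExp (-d))| := by
  have h1 := starExp_lower d
  have h2 := starExp_lower (-d)
  have h3 := starExp_pos (-d)
  have h4 := starExp_mul_neg d
  have h5 : -d ≤ -(starExp d - 1) * starExp (-d) := by nlinarith
  rw [abs_mul, abs_of_pos (by linarith : 0 < 1 + starExp (-d)), abs_le]
  have := neg_abs_le (starExp d - 1)
  have := le_abs_self (starExp d - 1)
  constructor <;> nlinarith [abs_nonneg (starExp d - 1)]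

/-- For a convex subring `O` of `ℝ*` closed under `*exp`, the
nonstandard exponential and logarithm induce mutually inverse maps `E`, `L`
between the residue field `O/o` and its positive part, with `E` an
order-preserving isomorphism from the additive group onto the multiplicative
group of positive elements; so the residue field is an exponential field. -/
theorem stmt8 (O : Subring Hyperreal)
    (hconv : ∀ x y : Hyperreal, x ∈ O → |y| ≤ |x| → y ∈ O)
    (hexp : ∀ x ∈ O, starExp x ∈ O)
    (I : Ideal O)
    (hI : ∀ x : O, x ∈ I ↔ ((x : Hyperreal) = 0 ∨ (x : Hyperreal)⁻¹ ∉ O))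
    (le : (O ⧸ I) → (O ⧸ I) → Prop)
    (hle : ∀ x y : O, le (Ideal.Quotient.mk I x) (Ideal.Quotient.mk I y) ↔
      ((x : Hyperreal) ≤ (y : Hyperreal) ∨ x - y ∈ I)) :
    ∃ E L : (O ⧸ I) → (O ⧸ I),
      -- E is induced by *exp
      (∀ f : O, E (Ideal.Quotient.mk I f) =
        Ideal.Quotient.mk I ⟨starExp (f : Hyperreal), hexp _ f.2⟩) ∧
      -- L is induced by *log on the positive part
      (∀ g : O, (le 0 (Ideal.Quotient.mk I g) ∧ Ideal.Quotient.mk I g ≠ 0) →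
        ∃ h : starLog (g : Hyperreal) ∈ O,
          L (Ideal.Quotient.mk I g) =
            Ideal.Quotient.mk I ⟨starLog (g : Hyperreal), h⟩) ∧
      -- E takes values in the positive elements
      (∀ a : O ⧸ I, le 0 (E a) ∧ E a ≠ 0) ∧
      -- E and L are mutually inverse
      (∀ a : O ⧸ I, L (E a) = a) ∧
      (∀ u : O ⧸ I, (le 0 u ∧ u ≠ 0) → E (L u) = u) ∧
      -- E turns addition into multiplication
      (∀ a b : O ⧸ I, E (a + b) = E a * E b) ∧
      -- E is strictly increasing
      (∀ a b : O ⧸ I, le a b → a ≠ b → le (E a) (E b) ∧ E a ≠ E b) := by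
  have hconvI : ∀ x y : O, x ∈ I → |(y : Hyperreal)| ≤ |(x : Hyperreal)| → y ∈ I := by
    intro x y hx hxy
    rw [hI] at hx ⊢
    by_contra! hc
    obtain ⟨hy0, hy⟩ := hc
    have hypos : 0 < |(y : Hyperreal)| := abs_pos.2 hy0
    rcases hx with hx | hx
    · rw [hx, abs_zero] at hxy
      exact absurd hxy (not_le.2 hypos)
    · apply hx
      apply hconv _ _ hy
      rw [abs_inv, abs_inv]
      exact inv_anti₀ hypos hxy
  let ex : O → O := fun f => ⟨starExp (f : Hyperreal), hexp _ f.2⟩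
  have ex_add : ∀ x y : O, ex (x + y) = ex x * ex y := fun x y =>
    Subtype.ext (starExp_add x y)
  have ex_sub : ∀ x y : O, ex x = ex y * ex (x - y) := fun x y => by
    rw [← ex_add]; congr 1; ring
  have ex_one : ∀ x : O, ex (-x) * ex x = 1 := fun x =>
    Subtype.ext (by rw [mul_comm]; exact starExp_mul_neg x)
  have hwd : ∀ x y : O, x - y ∈ I → ex x - ex y ∈ I := by
    intro x y h
    have h1 : ex (x - y) - 1 ∈ I :=
      hconvI ((x - y) * (1 + ex (x - y))) _ (I.mul_mem_right _ h)
        (abs_starExp_sub_one ((x - y : O) : Hyperreal))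
    have h2 : ex x - ex y = ex y * (ex (x - y) - 1) := by rw [ex_sub x y]; ring
    rw [h2]
    exact I.mul_mem_left _ h1
  have hinj : ∀ x y : O, ex x - ex y ∈ I → x - y ∈ I := by
    intro x y h
    have h1 : ex (x - y) - 1 ∈ I := by
      have h2 : ex (x - y) - 1 = ex (-y) * (ex x - ex y) := by
        rw [mul_sub, ex_one, ← ex_add]; congr 2; ring
      rw [h2]
      exact I.mul_mem_left _ h
    exact hconvI ((ex (x - y) - 1) * (1 + ex (-(x - y)))) _ (I.mul_mem_right _ h1)
        (abs_le_starExp_sub_one ((x - y : O) : Hyperreal))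
  let E : (O ⧸ I) → (O ⧸ I) := fun a => Ideal.Quotient.mk I (ex (Quotient.out a))
  have hE : ∀ f : O, E (Ideal.Quotient.mk I f) = Ideal.Quotient.mk I (ex f) := by
    intro f
    refine Ideal.Quotient.eq.2 (hwd _ _ (Ideal.Quotient.eq.1 ?_))
    exact Quotient.out_eq _
  have hEinj : Function.Injective E := by
    intro a b h
    obtain ⟨x, rfl⟩ := Ideal.Quotient.mk_surjective a
    obtain ⟨y, rfl⟩ := Ideal.Quotient.mk_surjective b
    rw [hE, hE] at h
    exact Ideal.Quotient.eq.2 (hinj _ _ (Ideal.Quotient.eq.1 h))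
  have hLE : ∀ a, Function.invFun E (E a) = a := Function.leftInverse_invFun hEinj
  have hlog : ∀ g : O, (le 0 (Ideal.Quotient.mk I g) ∧ Ideal.Quotient.mk I g ≠ 0) →
      ∃ h : starLog (g : Hyperreal) ∈ O,
        E (Ideal.Quotient.mk I ⟨starLog (g : Hyperreal), h⟩) = Ideal.Quotient.mk I g := by
    rintro g ⟨h1, h2⟩
    have h2' : g ∉ I := fun h => h2 (Ideal.Quotient.eq_zero_iff_mem.2 h)
    rw [← map_zero (Ideal.Quotient.mk I), hle, zero_sub, neg_mem_iff] at h1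
    have h3 := h1.resolve_right h2'
    have h4 := h2'
    rw [hI] at h4
    push Not at h4
    have hpos : 0 < (g : Hyperreal) := lt_of_le_of_ne h3 (Ne.symm h4.1)
    have hip := inv_pos.2 hpos
    have he := starExp_starLog hpos
    have hin : starExp (-starLog (g : Hyperreal)) = (g : Hyperreal)⁻¹ := by
      have := starExp_mul_neg (starLog (g : Hyperreal))
      rw [he] at this
      exact eq_inv_of_mul_eq_one_right this
    have b1 := starExp_lower (starLog (g : Hyperreal))
    have b2 := starExp_lower (-starLog (g : Hyperreal))
    rw [he] at b1
    rw [hin] at b2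
    have hmem : starLog (g : Hyperreal) ∈ O := by
      refine hconv _ _ (O.add_mem g.2 h4.2) ?_
      rw [abs_of_pos (add_pos hpos hip), abs_le]
      constructor <;> linarith
    refine ⟨hmem, ?_⟩
    rw [hE]
    exact congrArg _ (Subtype.ext he)
  refine ⟨E, Function.invFun E, hE, ?_, ?_, hLE, ?_, ?_, ?_⟩
  · intro g hg
    obtain ⟨h, h'⟩ := hlog g hg
    exact ⟨h, by rw [← h', hLE]⟩
  · intro a
    obtain ⟨x, rfl⟩ := Ideal.Quotient.mk_surjective a
    rw [hE]
    constructor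
    · rw [← map_zero (Ideal.Quotient.mk I), hle]
      exact Or.inl (starExp_nonneg x)
    · intro h
      rw [Ideal.Quotient.eq_zero_iff_mem, hI] at h
      rcases h with h | h
      · exact (starExp_pos (x : Hyperreal)).ne' h
      · apply h
        have h5 : (starExp (x : Hyperreal))⁻¹ = starExp (-(x : Hyperreal)) :=
          (eq_inv_of_mul_eq_one_right (starExp_mul_neg (x : Hyperreal))).symm
        change (starExp (x : Hyperreal))⁻¹ ∈ O
        rw [h5]
        exact hexp _ (O.neg_mem x.2)
  · intro u hu
    obtain ⟨g, rfl⟩ := Ideal.Quotient.mk_surjective u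
    obtain ⟨h, h'⟩ := hlog g hu
    rw [← h', hLE]
  · intro a b
    obtain ⟨x, rfl⟩ := Ideal.Quotient.mk_surjective a
    obtain ⟨y, rfl⟩ := Ideal.Quotient.mk_surjective b
    rw [← map_add, hE, hE, hE, ← map_mul, ex_add]
  · intro a b hab hne
    refine ⟨?_, fun h => hne (hEinj h)⟩
    obtain ⟨x, rfl⟩ := Ideal.Quotient.mk_surjective a
    obtain ⟨y, rfl⟩ := Ideal.Quotient.mk_surjective b
    rw [hE, hE, hle]
    rw [hle] at hab
    rcases hab with h | h
    · exact Or.inl (starExp_mono h)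
    · exact absurd (Ideal.Quotient.eq.2 h) hne
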